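/- Moderate deviation principle (one-sided form): let (t_n) be a sequence of positive reals with t_n → ∞ and t_n/σ_n² → 0 (equivalently t_n = o(log n)). Then for every x > 0, lim_{n → ∞} (1/t_n)·log P((f_0(T_n) − μ_n)/(√(t_n)·σ_n) ≥ x) = −x²/2, where P((f_0(T_n) − μ_n)/(√(t_n)·σ_n) ≥ x) := Σ_{k : k ≥ μ_n + x·√(t_n)·σ_n} p_k^(n). -/

import Mathlib

open Finset

/-- `p n k` is the probability `p_k^{(n)} = P(f_0(T_n) = k)` that the random convex chain
`T_n` has exactly `k` vertices (besides the two corners), given by Buchta's formula: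
`p_k^{(n)} = 2^k · Σ_{i_1+⋯+i_k = n, i_j ≥ 1} Π_{j=1}^{k} i_j / (s_j (s_j + 1))`,
where `s_j = i_1 + ⋯ + i_j`.  In particular `p 0 0 = 1` and `p n 0 = 0` for `n ≥ 1`,
and `p n k = 0` for `k > n`. -/
noncomputable def p (n k : ℕ) : ℝ :=
  2 ^ k *
    ∑ i ∈ (Fintype.piFinset fun _ : Fin k => Finset.Icc 1 n).filter
        (fun i => ∑ j, i j = n),
      ∏ j : Fin k,
        (i j : ℝ) /
          (((∑ l ∈ Finset.univ.filter (fun l => l ≤ j), i l : ℕ) : ℝ) *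
            (((∑ l ∈ Finset.univ.filter (fun l => l ≤ j), i l : ℕ) : ℝ) + 1))

/-- The mean `μ_n = E f_0(T_n) = Σ_{k=1}^n k p_k^{(n)}`. -/
noncomputable def μ (n : ℕ) : ℝ := ∑ k ∈ Finset.Icc 1 n, (k : ℝ) * p n k

/-- The variance `σ_n² = Var f_0(T_n) = Σ_{k=1}^n (k − μ_n)² p_k^{(n)}`. -/
noncomputable def σsq (n : ℕ) : ℝ := ∑ k ∈ Finset.Icc 1 n, ((k : ℝ) - μ n) ^ 2 * p n k

lemma p_nonneg (n k : ℕ) : 0 ≤ p n k := by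
  unfold p
  positivity

lemma p_zero_right (n : ℕ) : p n 0 = if n = 0 then 1 else 0 := by
  rcases eq_or_ne n 0 with rfl | h
  · simp [p]
  · simp [p, h, Ne.symm h]

lemma p_succ_right (n k : ℕ) :
    (n : ℝ) * (n + 1) * p n (k + 1) = 2 * ∑ m ∈ range n, ((n : ℝ) - m) * p m k := by
  rcases Nat.eq_zero_or_pos n with rfl | hn
  · simp
  have hpartial (f : Fin (k + 1) → ℕ) (j : Fin k) :
      ∑ l ∈ univ.filter (fun l => l ≤ j.castSucc), f l =
        ∑ l ∈ univ.filter (fun l => l ≤ j), f l.castSucc := by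
    rw [sum_filter, sum_filter, Fin.sum_univ_castSucc]
    simp
  have hlast (f : Fin (k + 1) → ℕ) :
      ∑ l ∈ univ.filter (fun l => l ≤ Fin.last k), f l = ∑ l, f l := by
    simp [Fin.le_last]
  unfold p
  simp_rw [mul_sum]
  rw [sum_sigma']
  symm
  refine sum_bij' (fun a _ => (Fin.snoc a.2 (n - a.1) : Fin (k + 1) → ℕ))
    (fun f _ => (⟨n - f (Fin.last k), Fin.init f⟩ : (_ : ℕ) × (Fin k → ℕ))) ?_ ?_ ?_ ?_ ?_
  · rintro ⟨m, f⟩ h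
    simp only [mem_sigma, mem_range, mem_filter, Fintype.mem_piFinset, mem_Icc] at h
    simp only [mem_filter, Fintype.mem_piFinset, mem_Icc, Fin.forall_fin_succ',
      Fin.snoc_castSucc, Fin.snoc_last, Fin.sum_univ_castSucc]
    refine ⟨⟨fun i => ⟨(h.2.1 i).1, (h.2.1 i).2.trans h.1.le⟩, by omega⟩, by omega⟩
  · intro f h
    simp only [mem_filter, Fintype.mem_piFinset, mem_Icc, Fin.forall_fin_succ',
      Fin.sum_univ_castSucc] at h
    simp only [mem_sigma, mem_range, mem_filter, Fintype.mem_piFinset, mem_Icc, Fin.init]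
    have hs (i : Fin k) : f i.castSucc ≤ ∑ j : Fin k, f j.castSucc :=
      single_le_sum (f := fun j : Fin k => f j.castSucc) (fun _ _ => Nat.zero_le _) (mem_univ i)
    refine ⟨by omega, fun i => ⟨(h.1.1 i).1, ?_⟩, by omega⟩
    have := hs i
    omega
  · rintro ⟨m, f⟩ h
    simp only [mem_sigma, mem_range] at h
    have h1 := h.1
    simp only [Fin.snoc_last, Fin.init_snoc]
    congr
    omega
  · intro f h
    simp only [mem_filter, Fintype.mem_piFinset, mem_Icc, Fin.forall_fin_succ'] at h
    have : n - (n - f (Fin.last k)) = f (Fin.last k) := by omega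
    simp only [this, Fin.snoc_init_self]
  · rintro ⟨m, f⟩ h
    simp only [mem_sigma, mem_range, mem_filter, Fintype.mem_piFinset, mem_Icc] at h
    obtain ⟨hm, hf, hsum⟩ := h
    have htot : ∑ l, (Fin.snoc f (n - m) : Fin (k + 1) → ℕ) l = n := by
      simp only [Fin.sum_univ_castSucc, Fin.snoc_castSucc, Fin.snoc_last, hsum]
      omega
    simp only [Fin.prod_univ_castSucc, hpartial, hlast, htot, Fin.snoc_castSucc, Fin.snoc_last]
    have hn' : (n : ℝ) ≠ 0 := by positivity
    have hn'' : (n : ℝ) + 1 ≠ 0 := by positivity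
    rw [Nat.cast_sub hm.le]
    field_simp
    ring

lemma p_eq_zero {n k : ℕ} (h : n < k) : p n k = 0 := by
  induction k generalizing n with
  | zero => omega
  | succ k ih =>
    rcases Nat.eq_zero_or_pos n with rfl | hn
    · rw [p, filter_eq_empty_iff.2, sum_empty, mul_zero]
      intro i hi
      simpa using Fintype.mem_piFinset.1 hi 0
    have := p_succ_right n k
    rw [sum_eq_zero fun m hm => by
      rw [ih (by have := mem_range.1 hm; omega), mul_zero], mul_zero] at this
    have hn' : (n : ℝ) * (n + 1) ≠ 0 := by positivity
    exact (mul_eq_zero.1 this).resolve_left hn'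

open Polynomial in
/-- The probability generating function of `p n`, as a polynomial. -/
noncomputable def genPoly (n : ℕ) : ℝ[X] := ∑ k ∈ range (n + 1), monomial k (p n k)

lemma coeff_genPoly (n k : ℕ) : (genPoly n).coeff k = p n k := by
  simp only [genPoly, Polynomial.finsetSum_coeff, Polynomial.coeff_monomial]
  rw [sum_ite_eq']
  split_ifs with h
  · rfl
  · rw [p_eq_zero (by simpa using h)]

open Polynomial in
lemma genPoly_eq_sum (n : ℕ) : C ((n : ℝ) * (n + 1)) * genPoly n =
    C 2 * X * ∑ m ∈ range n, C ((n : ℝ) - m) * genPoly m := by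
  ext k
  rw [coeff_C_mul, coeff_genPoly, mul_assoc (C 2), coeff_C_mul]
  cases k with
  | zero =>
    rw [coeff_X_mul_zero, mul_zero, p_zero_right]
    split_ifs with h <;> simp [h]
  | succ k =>
    simp only [coeff_X_mul, finsetSum_coeff, coeff_C_mul, coeff_genPoly]
    exact p_succ_right n k

open Polynomial in
lemma genPoly_zero : genPoly 0 = 1 := by
  simp [genPoly, p_zero_right]

open Polynomial in
lemma genPoly_one : genPoly 1 = X := by
  have h := genPoly_eq_sum 1
  have h2 : (C 2 : ℝ[X]) ≠ 0 := by simp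
  norm_num [genPoly_zero] at h
  simpa [Finset.Ico_add_one_right_eq_Icc] using h

open Polynomial in
lemma genPoly_add_two (n : ℕ) :
    C (((n : ℝ) + 2) * (n + 3)) * genPoly (n + 2) =
      (C (2 * ((n : ℝ) + 1) * (n + 2)) + C 2 * X) * genPoly (n + 1) -
        C ((n : ℝ) * (n + 1)) * genPoly n := by
  have h0 := genPoly_eq_sum n
  have h1 := genPoly_eq_sum (n + 1)
  have h2 := genPoly_eq_sum (n + 2)
  simp only [sum_range_succ, Nat.cast_add, Nat.cast_one, Nat.cast_ofNat] at h1 h2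
  have e1 : ∑ m ∈ range n, C ((n : ℝ) + 1 - m) * genPoly m =
      ∑ m ∈ range n, C ((n : ℝ) - m) * genPoly m + ∑ m ∈ range n, genPoly m := by
    rw [← sum_add_distrib]
    refine sum_congr rfl fun m _ => ?_
    simp only [map_sub, map_add, map_one]
    ring
  have e2 : ∑ m ∈ range n, C ((n : ℝ) + 2 - m) * genPoly m =
      ∑ m ∈ range n, C ((n : ℝ) - m) * genPoly m + 2 * ∑ m ∈ range n, genPoly m := by
    rw [mul_sum, ← sum_add_distrib]
    refine sum_congr rfl fun m _ => ?_
    simp only [map_sub, map_add, C_ofNat]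
    ring
  rw [e1] at h1
  rw [e2] at h2
  simp only [map_sub, map_add, map_mul, map_one, C_ofNat] at *
  linear_combination h2 - 2 * h1 + h0

open Polynomial in
lemma eval_one_genPoly (n : ℕ) : (genPoly n).eval 1 = 1 := by
  induction n using Nat.twoStepInduction with
  | zero => simp [genPoly_zero]
  | one => simp [genPoly_one]
  | more n h0 h1 =>
    have h := congrArg (eval 1) (genPoly_add_two n)
    simp only [eval_mul, eval_sub, eval_add, eval_C, eval_X, h0, h1] at h
    have : ((n : ℝ) + 2) * (n + 3) ≠ 0 := by positivity
    apply mul_left_cancel₀ this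
    rw [h]; ring

open Polynomial in
/-- Successive generating functions have ratio in the upper half-plane at points of the upper
half-plane; in particular they do not vanish there. -/
lemma im_aeval_genPoly_mul_conj_pos (n : ℕ) {z : ℂ} (hz : 0 < z.im) :
    0 < (aeval z (genPoly (n + 1)) * (starRingEnd ℂ) (aeval z (genPoly n))).im := by
  induction n with
  | zero => simpa [genPoly_zero, genPoly_one] using hz
  | succ n ih =>
    have h := congrArg (aeval z) (genPoly_add_two n)
    simp only [map_mul, map_sub, map_add, aeval_C, aeval_X] at h
    set u := aeval z (genPoly n)
    set v := aeval z (genPoly (n + 1))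
    set w := aeval z (genPoly (n + 1 + 1))
    change _ * w = _ at h
    have hv : 0 < Complex.normSq v := by
      rw [Complex.normSq_pos]
      rintro hv
      simp [hv] at ih
    have h' := congrArg (fun y => (y * (starRingEnd ℂ) v).im) h
    simp [Complex.normSq_apply] at h' hv ih ⊢
    have hc : 0 < ((n : ℝ) + 2) * (n + 3) := by positivity
    have hd : 0 ≤ (n : ℝ) * (n + 1) := by positivity
    nlinarith [mul_pos hz hv, mul_nonneg hd (sub_nonneg.2 ih.le)]

open Polynomial in
lemma genPoly_ne_zero (n : ℕ) : genPoly n ≠ 0 := by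
  intro h
  simpa [h] using eval_one_genPoly n

open Polynomial in
lemma aeval_genPoly_ne_zero (n : ℕ) {z : ℂ} (hz : z.im ≠ 0) : aeval z (genPoly n) ≠ 0 := by
  intro h
  rcases lt_or_gt_of_ne hz with hz | hz
  · have hc : aeval ((starRingEnd ℂ) z) (genPoly n) = 0 := by
      rw [aeval_conj, h, map_zero]
    have := im_aeval_genPoly_mul_conj_pos n (z := (starRingEnd ℂ) z) (by simpa using hz)
    simp [hc] at this
  · simpa [h] using im_aeval_genPoly_mul_conj_pos n hz

open Polynomial in
lemma splits_genPoly (n : ℕ) : (genPoly n).Splits := by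
  refine Splits.of_splits_map (algebraMap ℝ ℂ) (IsAlgClosed.splits _) fun z hz => ?_
  have h0 : aeval z (genPoly n) = 0 := by
    simpa [aeval_def, eval_map] using (mem_roots'.1 hz).2
  have him : z.im = 0 := by
    by_contra h
    exact aeval_genPoly_ne_zero n h h0
  exact ⟨z.re, Complex.ext (by simp) (by simp [him])⟩

lemma eval_genPoly (n : ℕ) (x : ℝ) : (genPoly n).eval x = ∑ k ∈ range (n + 1), p n k * x ^ k := by
  simp [genPoly, Polynomial.eval_finsetSum]

lemma eval_genPoly_pos (n : ℕ) {x : ℝ} (hx : 0 < x) : 0 < (genPoly n).eval x := by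
  have h1 := eval_one_genPoly n
  rw [eval_genPoly] at h1 ⊢
  obtain ⟨k, hk, hk0⟩ := exists_ne_zero_of_sum_ne_zero (h1.trans_ne one_ne_zero)
  have hpk : p n k ≠ 0 := left_ne_zero_of_mul hk0
  refine sum_pos' (fun i _ => mul_nonneg (p_nonneg n i) (by positivity)) ⟨k, hk, ?_⟩
  exact mul_pos ((p_nonneg n k).lt_of_ne' hpk) (by positivity)

/-- The probability generating function of the chain factors over the reals, with all roots
nonpositive. -/
lemma exists_prod_eq_sum_p (n : ℕ) (hn : n ≠ 0) : ∃ (c : ℝ) (R : Multiset ℝ), 0 < c ∧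
    (∀ r ∈ R, 0 ≤ r) ∧ ∀ θ : ℝ, ∑ k ∈ Icc 1 n, p n k * Real.exp (θ * k) =
      c * (R.map fun r => Real.exp θ + r).prod := by
  refine ⟨(genPoly n).leadingCoeff, (genPoly n).roots.map fun r => -r, ?_, ?_, fun θ => ?_⟩
  · refine lt_of_le_of_ne' ?_ (Polynomial.leadingCoeff_ne_zero.2 (genPoly_ne_zero n))
    rw [Polynomial.leadingCoeff, coeff_genPoly]
    exact p_nonneg _ _
  · intro r hr
    obtain ⟨s, hs, rfl⟩ := Multiset.mem_map.1 hr
    by_contra! h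
    exact (eval_genPoly_pos n (show 0 < s by linarith)).ne' (Polynomial.mem_roots'.1 hs).2
  · have h := (splits_genPoly n).eval_eq_prod_roots (Real.exp θ)
    rw [eval_genPoly, range_eq_Ico, sum_eq_sum_Ico_succ_bot (by omega), p_zero_right, if_neg hn,
      zero_mul, zero_add] at h
    simp only [Multiset.map_map, Function.comp_def, ← sub_eq_add_neg]
    rw [← h]
    refine sum_congr rfl fun k _ => ?_
    rw [mul_comm θ, Real.exp_nat_mul]

lemma sum_p (n : ℕ) (hn : n ≠ 0) : ∑ k ∈ Icc 1 n, p n k = 1 := by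
  have h := eval_one_genPoly n
  rw [eval_genPoly, range_eq_Ico, sum_eq_sum_Ico_succ_bot (by omega), p_zero_right, if_neg hn,
      zero_mul, zero_add] at h
  simpa [Finset.Ico_add_one_right_eq_Icc] using h

lemma p_one_right (n : ℕ) (hn : n ≠ 0) : p n 1 = 2 / (n + 1) := by
  have h := p_succ_right n 0
  simp only [p_zero_right] at h
  rw [sum_eq_single_of_mem 0 (mem_range.2 (by omega)) (fun m _ hm => by simp [hm])] at h
  have : (n : ℝ) ≠ 0 := by positivity
  have : (n : ℝ) + 1 ≠ 0 := by positivity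
  simp at h
  field_simp
  apply mul_left_cancel₀ ‹(n : ℝ) ≠ 0›
  linarith

lemma σsq_pos (n : ℕ) (hn : 2 ≤ n) : 0 < σsq n := by
  have hnn (k : ℕ) : 0 ≤ ((k : ℝ) - μ n) ^ 2 * p n k := mul_nonneg (sq_nonneg _) (p_nonneg _ _)
  refine lt_of_le_of_ne' (sum_nonneg fun k _ => hnn k) fun h => ?_
  have h0 := (sum_eq_zero_iff_of_nonneg fun k _ => hnn k).1 h
  have hp1 : p n 1 = 2 / (n + 1) := p_one_right n (by omega)
  have hn' : (2 : ℝ) ≤ n := by exact_mod_cast hn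
  have hμ : μ n = 1 := by
    have := h0 1 (by simp; omega)
    have hp : p n 1 ≠ 0 := by rw [hp1]; positivity
    have := pow_eq_zero_iff (two_ne_zero) |>.1 ((mul_eq_zero.1 this).resolve_right hp)
    push_cast at this
    linarith
  have hs := sum_p n (by omega)
  rw [sum_eq_single_of_mem 1 (by simp; omega), hp1] at hs
  · field_simp at hs
    linarith
  · intro k hk hk1
    refine (mul_eq_zero.1 (h0 k hk)).resolve_left (pow_ne_zero 2 ?_)
    rw [hμ, sub_ne_zero]
    exact_mod_cast hk1

/-- The exponential moments `∑ k ∈ s, k ^ j * w k * exp (θ * k)` of a finite weight. -/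
noncomputable def expMoment (s : Finset ℕ) (w : ℕ → ℝ) (j : ℕ) (θ : ℝ) : ℝ :=
  ∑ k ∈ s, (k : ℝ) ^ j * (w k * Real.exp (θ * k))

lemma hasDerivAt_expMoment (s : Finset ℕ) (w : ℕ → ℝ) (j : ℕ) (θ : ℝ) :
    HasDerivAt (expMoment s w j) (expMoment s w (j + 1) θ) θ := by
  unfold expMoment
  refine HasDerivAt.fun_sum fun k _ => ?_
  have h := ((((hasDerivAt_id θ).mul_const (k : ℝ)).exp).const_mul (w k)).const_mul ((k : ℝ) ^ j)
  refine h.congr_deriv ?_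
  simp only [id]
  ring

/-- The mean of a sum of independent Bernoulli variables tilted by `θ`, where the variable attached
to `r` succeeds with probability `1 / (1 + r)`. -/
noncomputable def tiltedMean (R : Multiset ℝ) (θ : ℝ) : ℝ :=
  (R.map fun r => Real.exp θ / (Real.exp θ + r)).sum

/-- The variance of a sum of independent Bernoulli variables tilted by `θ`. -/
noncomputable def tiltedVar (R : Multiset ℝ) (θ : ℝ) : ℝ :=
  (R.map fun r => r * Real.exp θ / (Real.exp θ + r) ^ 2).sum

lemma hasDerivAt_prod_exp_add (R : Multiset ℝ) (hR : ∀ r ∈ R, 0 ≤ r) (θ : ℝ) :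
    HasDerivAt (fun θ => (R.map fun r => Real.exp θ + r).prod)
      ((R.map fun r => Real.exp θ + r).prod * tiltedMean R θ) θ := by
  induction R using Multiset.induction with
  | empty => simpa [tiltedMean] using hasDerivAt_const θ (1 : ℝ)
  | cons a R ih =>
    have ha : 0 < Real.exp θ + a := add_pos_of_pos_of_nonneg (Real.exp_pos θ) (hR a (by simp))
    have h := ((Real.hasDerivAt_exp θ).add_const a).mul
      (ih fun r hr => hR r (Multiset.mem_cons_of_mem hr))
    simp only [Multiset.map_cons, Multiset.prod_cons]
    refine h.congr_deriv ?_
    simp only [tiltedMean, Multiset.map_cons, Multiset.sum_cons]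
    field_simp

lemma hasDerivAt_tiltedMean (R : Multiset ℝ) (hR : ∀ r ∈ R, 0 ≤ r) (θ : ℝ) :
    HasDerivAt (tiltedMean R) (tiltedVar R θ) θ := by
  unfold tiltedMean tiltedVar
  induction R using Multiset.induction with
  | empty => simpa using hasDerivAt_const θ (0 : ℝ)
  | cons a R ih =>
    have ha : 0 < Real.exp θ + a := add_pos_of_pos_of_nonneg (Real.exp_pos θ) (hR a (by simp))
    simp only [Multiset.map_cons, Multiset.sum_cons]
    refine HasDerivAt.add ?_ (ih fun r hr => hR r (Multiset.mem_cons_of_mem hr))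
    refine ((Real.hasDerivAt_exp θ).div ((Real.hasDerivAt_exp θ).add_const a) ha.ne').congr_deriv ?_
    ring

lemma tiltedVar_le (R : Multiset ℝ) (hR : ∀ r ∈ R, 0 ≤ r) {θ : ℝ} (hθ : 0 ≤ θ) :
    tiltedVar R θ ≤ Real.exp θ * tiltedVar R 0 := by
  unfold tiltedVar
  rw [← Multiset.sum_map_mul_left]
  refine Multiset.sum_map_le_sum_map _ _ fun r hr => ?_
  have hr := hR r hr
  have he := Real.one_le_exp hθ
  rw [Real.exp_zero, mul_one, mul_div_assoc', mul_comm r]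
  gcongr

lemma le_tiltedVar (R : Multiset ℝ) (hR : ∀ r ∈ R, 0 ≤ r) {θ : ℝ} (hθ : 0 ≤ θ) :
    Real.exp (-θ) * tiltedVar R 0 ≤ tiltedVar R θ := by
  unfold tiltedVar
  rw [← Multiset.sum_map_mul_left]
  refine Multiset.sum_map_le_sum_map _ _ fun r hr => ?_
  have hr := hR r hr
  have he := Real.one_le_exp hθ
  have h : (Real.exp θ + r) ^ 2 ≤ (Real.exp θ * (1 + r)) ^ 2 := by
    gcongr
    nlinarith
  rw [Real.exp_zero, mul_one, Real.exp_neg, inv_mul_eq_div, div_div,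
    div_le_div_iff₀ (by positivity) (by positivity)]
  calc r * (Real.exp θ + r) ^ 2 ≤ r * (Real.exp θ * (1 + r)) ^ 2 := by gcongr
    _ = _ := by ring

/-- First and second order Taylor bounds from an upper bound on the second derivative. -/
lemma taylor_le_of_deriv2_le {f f' f'' : ℝ → ℝ} (hf : ∀ x, HasDerivAt f (f' x) x)
    (hf' : ∀ x, HasDerivAt f' (f'' x) x) {T B : ℝ} (hT : 0 ≤ T)
    (hB : ∀ x ∈ Set.Icc 0 T, f'' x ≤ B) :
    f' T ≤ f' 0 + B * T ∧ f T ≤ f 0 + f' 0 * T + B * T ^ 2 / 2 := by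
  have h1 : ∀ x ∈ Set.Icc 0 T, f' x ≤ f' 0 + B * x := by
    refine image_le_of_deriv_right_le_deriv_boundary (f := f') (f' := f'')
      (B := fun x => f' 0 + B * x) (B' := fun _ => B)
      (fun x _ => (hf' x).continuousAt.continuousWithinAt) (fun x _ => (hf' x).hasDerivWithinAt)
      (by simp) (by fun_prop) (fun x _ => ?_) fun x hx => hB x ⟨hx.1, hx.2.le⟩
    simpa using (((hasDerivAt_id x).const_mul B).const_add (f' 0)).hasDerivWithinAt
  have h2 : ∀ x ∈ Set.Icc 0 T, f x ≤ f 0 + f' 0 * x + B * x ^ 2 / 2 := by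
    refine image_le_of_deriv_right_le_deriv_boundary (f := f) (f' := f')
      (B := fun x => f 0 + f' 0 * x + B * x ^ 2 / 2) (B' := fun x => f' 0 + B * x)
      (fun x _ => (hf x).continuousAt.continuousWithinAt) (fun x _ => (hf x).hasDerivWithinAt)
      (by simp) (by fun_prop) (fun x _ => ?_) fun x hx => h1 x ⟨hx.1, hx.2.le⟩
    refine HasDerivAt.hasDerivWithinAt ?_
    refine ((((hasDerivAt_id x).const_mul (f' 0)).const_add (f 0)).add
      ((((hasDerivAt_id x).pow 2).const_mul B).div_const 2)).congr_deriv ?_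
    simp
    ring
  exact ⟨h1 T ⟨hT, le_rfl⟩, h2 T ⟨hT, le_rfl⟩⟩

/-- The tilted moments of the number of vertices: log-moment generating function, tilted mean and
tilted variance, with second order control by the untilted variance. -/
lemma exists_tilted_bounds (n : ℕ) (hn : n ≠ 0) {θ : ℝ} (hθ : 0 ≤ θ) : ∃ M m V : ℝ, 0 < M ∧
    ∑ k ∈ Icc 1 n, p n k * Real.exp (θ * k) = M ∧
    ∑ k ∈ Icc 1 n, ((k : ℝ) - m) ^ 2 * (p n k * Real.exp (θ * k)) = M * V ∧
    V ≤ Real.exp θ * σsq n ∧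
    m ≤ μ n + θ * Real.exp θ * σsq n ∧
    μ n + θ * Real.exp (-θ) * σsq n ≤ m ∧
    Real.log M ≤ θ * μ n + θ ^ 2 * Real.exp θ * σsq n / 2 ∧
    θ * μ n + θ ^ 2 * Real.exp (-θ) * σsq n / 2 ≤ Real.log M := by
  obtain ⟨c, R, hc, hR, hfac⟩ := exists_prod_eq_sum_p n hn
  set E := expMoment (Icc 1 n) (p n) with hE
  have hE0 (θ : ℝ) : E 0 θ = ∑ k ∈ Icc 1 n, p n k * Real.exp (θ * k) := by
    simp [hE, expMoment]
  have hEfac : E 0 = fun θ => c * (R.map fun r => Real.exp θ + r).prod := by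
    funext θ
    rw [hE0, hfac]
  have hpos (θ : ℝ) : 0 < E 0 θ := by
    rw [hEfac]
    refine mul_pos hc (Multiset.prod_pos fun y hy => ?_)
    obtain ⟨r, hr, rfl⟩ := Multiset.mem_map.1 hy
    exact add_pos_of_pos_of_nonneg (Real.exp_pos θ) (hR r hr)
  have hd (j : ℕ) (θ : ℝ) : HasDerivAt (E j) (E (j + 1) θ) θ := hasDerivAt_expMoment _ _ _ _
  have hE1 (θ : ℝ) : E 1 θ = E 0 θ * tiltedMean R θ := by
    refine (hd 0 θ).unique ?_
    have := (hasDerivAt_prod_exp_add R hR θ).const_mul c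
    rw [← mul_assoc] at this
    rw [hEfac]
    exact this
  have hE1' : E 1 = fun θ => E 0 θ * tiltedMean R θ := funext hE1
  have hE2 (θ : ℝ) : E 2 θ = E 0 θ * (tiltedVar R θ + tiltedMean R θ ^ 2) := by
    refine (hd 1 θ).unique ?_
    rw [hE1']
    refine ((hd 0 θ).mul (hasDerivAt_tiltedMean R hR θ)).congr_deriv ?_
    rw [zero_add, hE1]
    ring
  have hvar (θ : ℝ) : ∑ k ∈ Icc 1 n, ((k : ℝ) - tiltedMean R θ) ^ 2 * (p n k * Real.exp (θ * k)) =
      E 0 θ * tiltedVar R θ := by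
    have : ∑ k ∈ Icc 1 n, ((k : ℝ) - tiltedMean R θ) ^ 2 * (p n k * Real.exp (θ * k)) =
        E 2 θ - 2 * tiltedMean R θ * E 1 θ + tiltedMean R θ ^ 2 * E 0 θ := by
      simp only [hE, expMoment, mul_sum]
      rw [← sum_sub_distrib, ← sum_add_distrib]
      refine sum_congr rfl fun k _ => ?_
      ring
    rw [this, hE1, hE2]
    ring
  have hE00 : E 0 0 = 1 := by rw [hE0, ← sum_p n hn]; simp
  have hmean0 : tiltedMean R 0 = μ n := by
    have h := hE1 0
    rw [hE00, one_mul] at h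
    rw [← h]
    simp [hE, expMoment, μ]
  have hvar0 : tiltedVar R 0 = σsq n := by
    have h := hvar 0
    rw [hE00, one_mul, hmean0] at h
    rw [← h]
    simp [σsq]
  have hlog (θ : ℝ) : HasDerivAt (fun θ => Real.log (E 0 θ)) (tiltedMean R θ) θ := by
    refine ((hd 0 θ).log (hpos θ).ne').congr_deriv ?_
    rw [zero_add, hE1, mul_div_cancel_left₀ _ (hpos θ).ne']
  have hσ : 0 ≤ σsq n := sum_nonneg fun k _ => mul_nonneg (sq_nonneg _) (p_nonneg _ _)
  have hup := taylor_le_of_deriv2_le hlog (hasDerivAt_tiltedMean R hR) hθ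
    (B := Real.exp θ * σsq n) fun x hx => by
      refine (tiltedVar_le R hR hx.1).trans ?_
      rw [hvar0]
      gcongr
      exact hx.2
  have hlow := taylor_le_of_deriv2_le (fun x => (hlog x).neg)
    (fun x => (hasDerivAt_tiltedMean R hR x).neg) hθ (B := -(Real.exp (-θ) * σsq n)) fun x hx => by
      refine neg_le_neg (le_trans ?_ (le_tiltedVar R hR hx.1))
      rw [hvar0]
      gcongr
      exact hx.2
  simp only [Pi.neg_apply, hE00, hmean0, Real.log_one] at hup hlow
  refine ⟨E 0 θ, tiltedMean R θ, tiltedVar R θ, hpos θ, (hE0 θ).symm, hvar θ, ?_, ?_, ?_, ?_, ?_⟩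
  · rw [← hvar0]
    exact tiltedVar_le R hR hθ
  · linarith [hup.1]
  · linarith [hlow.1]
  · linarith [hup.2]
  · linarith [hlow.2]

/-- The upper tail probability `P(f_0(T_n) ≥ a)`. -/
noncomputable def upperTail (n : ℕ) (a : ℝ) : ℝ :=
  ∑ k ∈ (Icc 1 n).filter (fun k : ℕ => a ≤ (k : ℝ)), p n k

lemma upperTail_le (n : ℕ) (hn : n ≠ 0) {θ : ℝ} (hθ : 0 ≤ θ) (a : ℝ) :
    upperTail n a ≤ Real.exp (-θ * a + θ * μ n + θ ^ 2 * Real.exp θ * σsq n / 2) := by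
  obtain ⟨M, m, V, hM, hsum, -, -, -, -, hlog, -⟩ := exists_tilted_bounds n hn hθ
  calc upperTail n a
      ≤ ∑ k ∈ (Icc 1 n).filter (fun k : ℕ => a ≤ (k : ℝ)),
          Real.exp (-θ * a) * (p n k * Real.exp (θ * k)) := by
        refine sum_le_sum fun k hk => ?_
        have hk := (mem_filter.1 hk).2
        have h1 : 1 ≤ Real.exp (-θ * a) * Real.exp (θ * k) := by
          rw [← Real.exp_add]
          exact Real.one_le_exp (by nlinarith)
        nlinarith [p_nonneg n k]
    _ ≤ ∑ k ∈ Icc 1 n, Real.exp (-θ * a) * (p n k * Real.exp (θ * k)) := by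
        refine sum_le_sum_of_subset_of_nonneg (filter_subset _ _) fun k _ _ => ?_
        have := p_nonneg n k
        positivity
    _ = Real.exp (-θ * a) * M := by rw [← mul_sum, hsum]
    _ ≤ _ := by
        rw [add_assoc, Real.exp_add]
        gcongr
        exact (Real.log_le_iff_le_exp hM).1 hlog

lemma le_upperTail (n : ℕ) (hn : n ≠ 0) {θ D a b : ℝ} (hθ : 0 ≤ θ) (hD : 0 < D)
    (ha : a + D ≤ μ n + θ * Real.exp (-θ) * σsq n)
    (hb : μ n + θ * Real.exp θ * σsq n + D ≤ b) (hV : Real.exp θ * σsq n ≤ D ^ 2 / 2) :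
    Real.exp (-θ * b + θ * μ n + θ ^ 2 * Real.exp (-θ) * σsq n / 2) / 2 ≤ upperTail n a := by
  obtain ⟨M, m, V, hM, hsum, hvar, hV', hm, hm', -, hlog⟩ := exists_tilted_bounds n hn hθ
  have hp := p_nonneg n
  have hsplit := sum_filter_add_sum_filter_not (Icc 1 n) (fun k : ℕ => |(k : ℝ) - m| ≤ D)
    fun k => p n k * Real.exp (θ * k)
  have hcheb : D ^ 2 * ∑ k ∈ (Icc 1 n).filter (fun k : ℕ => ¬ |(k : ℝ) - m| ≤ D),
      p n k * Real.exp (θ * k) ≤ M * V := by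
    rw [← hvar, mul_sum]
    refine le_trans (sum_le_sum fun k hk => ?_)
      (sum_le_sum_of_subset_of_nonneg (filter_subset _ _) fun k _ _ =>
        mul_nonneg (sq_nonneg _) (mul_nonneg (hp k) (Real.exp_pos _).le))
    have hk := not_le.1 (mem_filter.1 hk).2
    refine mul_le_mul_of_nonneg_right ?_ (mul_nonneg (hp k) (Real.exp_pos _).le)
    rw [← sq_abs ((k : ℝ) - m)]
    gcongr
  have hhalf : M / 2 ≤ ∑ k ∈ (Icc 1 n).filter (fun k : ℕ => |(k : ℝ) - m| ≤ D),
      p n k * Real.exp (θ * k) := by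
    have h1 : M * V ≤ D ^ 2 * (M / 2) := by nlinarith
    have := le_of_mul_le_mul_left (hcheb.trans h1) (by positivity)
    linarith
  have hmono : ∑ k ∈ (Icc 1 n).filter (fun k : ℕ => |(k : ℝ) - m| ≤ D),
      p n k * Real.exp (θ * k) ≤ Real.exp (θ * b) * upperTail n a := by
    rw [upperTail, mul_sum]
    refine (sum_le_sum fun k hk => ?_).trans (sum_le_sum_of_subset_of_nonneg ?_ fun k _ _ =>
      mul_nonneg (Real.exp_pos (θ * b)).le (hp k))
    · have hk := abs_le.1 (mem_filter.1 hk).2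
      rw [mul_comm]
      refine mul_le_mul_of_nonneg_right (Real.exp_le_exp.2 ?_) (hp k)
      gcongr
      linarith [hk.2]
    · refine monotone_filter_right _ fun k _ hk => ?_
      linarith [(abs_le.1 hk).1]
  have hMexp := (Real.le_log_iff_exp_le hM).1 hlog
  calc _ = Real.exp (-θ * b) *
        (Real.exp (θ * μ n + θ ^ 2 * Real.exp (-θ) * σsq n / 2) / 2) := by
        rw [add_assoc, Real.exp_add]
        ring
    _ ≤ Real.exp (-θ * b) * (Real.exp (θ * b) * upperTail n a) := by
        gcongr
        linarith
    _ = upperTail n a := by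
        rw [← mul_assoc, ← Real.exp_add]
        simp

/-- Moderate deviation principle (one-sided form): for every sequence `(t_n)` of positive
reals with `t_n → ∞` and `t_n/σ_n² → 0` (equivalently `t_n = o(log n)`), and every `x > 0`,
`(1/t_n) log P((f_0(T_n) − μ_n)/(√(t_n) σ_n) ≥ x) → −x²/2` as `n → ∞`, where the
probability is `Σ_{k ≥ μ_n + x √(t_n) σ_n} p_k^{(n)}`. -/
theorem moderate_deviations_one_sided (t : ℕ → ℝ) (ht_pos : ∀ n, 0 < t n)
    (ht_top : Filter.Tendsto t Filter.atTop Filter.atTop)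
    (ht_small : Filter.Tendsto (fun n : ℕ => t n / σsq n) Filter.atTop (nhds 0))
    (x : ℝ) (hx : 0 < x) :
    Filter.Tendsto
      (fun n : ℕ =>
        1 / t n *
          Real.log
            (∑ k ∈ (Finset.Icc 1 n).filter
                (fun k : ℕ => μ n + x * Real.sqrt (t n) * Real.sqrt (σsq n) ≤ (k : ℝ)),
              p n k))
      Filter.atTop (nhds (-(x ^ 2) / 2)) := by
  change Filter.Tendsto (fun n : ℕ => 1 / t n *
    Real.log (upperTail n (μ n + x * Real.sqrt (t n) * Real.sqrt (σsq n)))) _ _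
  set e : ℕ → ℝ := fun n => Real.sqrt (t n / σsq n) with he
  have he0 : Filter.Tendsto e Filter.atTop (nhds 0) := by
    simpa using ht_small.sqrt
  have henn (n : ℕ) : 0 ≤ e n := Real.sqrt_nonneg _
  have hsq : ∀ n, 2 ≤ n → t n = e n ^ 2 * σsq n := fun n hn => by
    have hσ := σsq_pos n hn
    rw [he, Real.sq_sqrt (div_nonneg (ht_pos n).le hσ.le)]
    field_simp
  have hprod : ∀ n, 2 ≤ n → Real.sqrt (t n) * Real.sqrt (σsq n) = e n * σsq n := fun n hn => by
    have hσ := σsq_pos n hn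
    rw [hsq n hn, Real.sqrt_mul (sq_nonneg _), Real.sqrt_sq (henn n), mul_assoc,
      Real.mul_self_sqrt hσ.le]
  have hexp (y : ℝ) : Filter.Tendsto (fun n => Real.exp (y * e n)) Filter.atTop (nhds 1) := by
    simpa using (he0.const_mul y).rexp
  have hlower {δ : ℝ} (hδ : 0 < δ) : ∀ᶠ n in Filter.atTop,
      Real.exp (t n * (-(x + δ) * (x + 2 * δ) + (x + δ) ^ 2 * Real.exp (-(x + δ) * e n) / 2)) / 2 ≤
        upperTail n (μ n + x * Real.sqrt (t n) * Real.sqrt (σsq n)) := by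
    have h1 : ∀ᶠ n in Filter.atTop, x + δ / 2 < (x + δ) * Real.exp (-(x + δ) * e n) :=
      ((hexp _).const_mul _).eventually_const_lt (by linarith)
    have h2 : ∀ᶠ n in Filter.atTop, (x + δ) * Real.exp ((x + δ) * e n) < x + 3 / 2 * δ :=
      ((hexp _).const_mul _).eventually_lt_const (by linarith)
    have h3 : ∀ᶠ n in Filter.atTop, Real.exp ((x + δ) * e n) < 2 :=
      (hexp _).eventually_lt_const (by norm_num)
    filter_upwards [h1, h2, h3, Filter.eventually_ge_atTop 2,
      ht_top.eventually_ge_atTop (16 / δ ^ 2)] with n h1 h2 h3 hn h4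
    have hσ := σsq_pos n hn
    have ht := hsq n hn
    have heσ : 0 < e n * σsq n := by
      rw [← hprod n hn]
      exact mul_pos (Real.sqrt_pos.2 (ht_pos n)) (Real.sqrt_pos.2 hσ)
    rw [mul_assoc x, hprod n hn]
    have h := le_upperTail n (by omega) (θ := (x + δ) * e n) (D := δ / 2 * (e n * σsq n))
      (a := μ n + x * (e n * σsq n)) (b := μ n + (x + 2 * δ) * (e n * σsq n))
      (mul_nonneg (by positivity) (henn n)) (by positivity)
      (by rw [← neg_mul]; nlinarith) (by nlinarith) (by
        rw [div_le_iff₀ (by positivity)] at h4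
        have : (δ / 2 * (e n * σsq n)) ^ 2 / 2 = t n * δ ^ 2 / 8 * σsq n := by rw [ht]; ring
        rw [this]
        gcongr
        linarith)
    refine le_trans (le_of_eq ?_) h
    rw [← neg_mul, ht]
    congr 2
    ring
  refine tendsto_order.2 ⟨fun c hc => ?_, fun c hc => ?_⟩
  · obtain ⟨δ, hδc, hδ⟩ : ∃ δ : ℝ, c < -(x + δ) * (x + 2 * δ) + (x + δ) ^ 2 / 2 ∧ 0 < δ := by
      have hcont : Filter.Tendsto (fun δ : ℝ => -(x + δ) * (x + 2 * δ) + (x + δ) ^ 2 / 2)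
          (nhdsWithin 0 (Set.Ioi 0)) (nhds (-(x + 0) * (x + 2 * 0) + (x + 0) ^ 2 / 2)) :=
        (Continuous.tendsto (by fun_prop) 0).mono_left nhdsWithin_le_nhds
      exact ((hcont.eventually_const_lt (by linarith)).and self_mem_nhdsWithin).exists
    have hlim : Filter.Tendsto (fun n => -(x + δ) * (x + 2 * δ) +
        (x + δ) ^ 2 * Real.exp (-(x + δ) * e n) / 2 - Real.log 2 / t n) Filter.atTop
        (nhds (-(x + δ) * (x + 2 * δ) + (x + δ) ^ 2 * 1 / 2 - 0)) :=
      ((((hexp _).const_mul _).div_const 2).const_add _).sub (ht_top.const_div_atTop _)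
    filter_upwards [hlower hδ, hlim.eventually_const_lt (u := c) (by linarith)] with n h1 h2
    refine h2.trans_le ?_
    have h := Real.log_le_log (by positivity) h1
    rw [Real.log_div (Real.exp_ne_zero _) two_ne_zero, Real.log_exp] at h
    have ht := ht_pos n
    rw [one_div_mul_eq_div, le_div_iff₀ ht, sub_mul, div_mul_cancel₀ _ ht.ne']
    linarith
  · have hlim : Filter.Tendsto (fun n => -x ^ 2 + x ^ 2 * Real.exp (x * e n) / 2) Filter.atTop
        (nhds (-x ^ 2 + x ^ 2 * 1 / 2)) :=
      (((hexp _).const_mul _).div_const 2).const_add _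
    filter_upwards [hlower one_pos, hlim.eventually_lt_const (u := c) (by linarith),
      Filter.eventually_ge_atTop 2] with n h1 h2 hn
    refine lt_of_le_of_lt ?_ h2
    have hpos := lt_of_lt_of_le (by positivity) h1
    have hup := upperTail_le n (by omega) (mul_nonneg hx.le (henn n))
      (μ n + x * Real.sqrt (t n) * Real.sqrt (σsq n))
    have h := (Real.log_le_iff_le_exp hpos).2 hup
    have ht := ht_pos n
    rw [one_div_mul_eq_div, div_le_iff₀ ht]
    refine h.trans (le_of_eq ?_)
    rw [mul_assoc x, hprod n hn, hsq n hn]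
    ring
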